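/- There do not exist families of 2×2 complex matrices A, B, C, D : Fin 2 → Matrix (Fin 2) (Fin 2) ℂ such that for all i, j, k, l ∈ Fin 2, trace(A i * B j * C k * D l) = (if i = k then 1 else 0) * (if j = l then 1 else 0). (Equivalently, the crossed distribution of two EPR pairs over a square-shaped quantum network whose four channels each have dimension 2 is impossible by SLOCC.) -/

import Mathlib

open Matrix

namespace SquareNetwork

variable {K : Type*} [Field K]

/-- The linear combination of a pair of matrices with coefficient vector `u`. -/
def pencil (M : Fin 2 → Matrix (Fin 2) (Fin 2) K) (u : Fin 2 → K) : Matrix (Fin 2) (Fin 2) K :=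
  u 0 • M 0 + u 1 • M 1

theorem trace_pencil_mul {A B C D : Fin 2 → Matrix (Fin 2) (Fin 2) K}
    (h : ∀ i j k l : Fin 2, (A i * B j * C k * D l).trace =
      (if i = k then 1 else 0) * (if j = l then 1 else 0)) (u v w z : Fin 2 → K) :
    (pencil A u * pencil B v * pencil C w * pencil D z).trace = (u ⬝ᵥ w) * (v ⬝ᵥ z) := by
  simp only [pencil, add_mul, mul_add, smul_mul_assoc, mul_smul_comm, trace_add, trace_smul, h,
    dotProduct, Fin.sum_univ_two, smul_eq_mul]
  simp
  ring

theorem exists_det_pencil_eq_zero [IsAlgClosed K] [NeZero (2 : K)]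
    (M : Fin 2 → Matrix (Fin 2) (Fin 2) K) : ∃ u : Fin 2 → K, u ≠ 0 ∧ (pencil M u).det = 0 := by
  by_cases h1 : (M 1).det = 0
  · exact ⟨![0, 1], fun h => by simpa using congrFun h 1, by simpa [pencil] using h1⟩
  · obtain ⟨s, hs⟩ := IsAlgClosed.exists_eq_mul_self (discrim (M 1).det
      (M 0 0 0 * M 1 1 1 + M 1 0 0 * M 0 1 1 - M 0 0 1 * M 1 1 0 - M 1 0 1 * M 0 1 0) (M 0).det)
    obtain ⟨t, ht⟩ := exists_quadratic_eq_zero h1 ⟨s, hs⟩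
    refine ⟨![1, t], fun h => by simpa using congrFun h 0, ?_⟩
    simp only [det_fin_two] at ht
    simp [pencil, det_fin_two]
    linear_combination ht

theorem exists_eq_vecMulVec_of_det_eq_zero {M : Matrix (Fin 2) (Fin 2) K} (hM : M.det = 0) :
    ∃ p q : Fin 2 → K, M = vecMulVec p q := by
  rw [det_fin_two] at hM
  by_cases h : M 0 = 0
  · refine ⟨![0, 1], M 1, ?_⟩
    ext i j
    fin_cases i <;> simp [vecMulVec_apply, h]
  · obtain ⟨k, hk⟩ := Function.ne_iff.mp h
    refine ⟨![1, M 1 k / M 0 k], M 0, ?_⟩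
    have hk' : M 0 k ≠ 0 := hk
    ext i j
    fin_cases i <;> fin_cases j <;> fin_cases k <;>
      simp [vecMulVec_apply] at hk' ⊢ <;> field_simp <;>
      first | linear_combination hM | linear_combination -hM

/-- If `p qᵀ` is injective on the pencil of `B`, then the rows `qᵀ B j` separate vectors. -/
theorem eq_zero_of_dotProduct_mulVec_eq_zero {p q x : Fin 2 → K}
    {B : Fin 2 → Matrix (Fin 2) (Fin 2) K}
    (h : ∀ v, vecMulVec p q * pencil B v = 0 → v = 0)
    (hx : ∀ j, q ⬝ᵥ (B j *ᵥ x) = 0) : x = 0 := by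
  let Q : Matrix (Fin 2) (Fin 2) K := of fun j => q ᵥ* B j
  have hQ : Q.det ≠ 0 := by
    intro h0
    obtain ⟨v, hv, hv0⟩ := exists_vecMul_eq_zero_iff.mpr h0
    refine hv (h v ?_)
    have : q ᵥ* pencil B v = v ᵥ* Q := by
      ext i
      simp only [pencil, Q, vecMul, dotProduct, Fin.sum_univ_two, Matrix.add_apply,
        Matrix.smul_apply, smul_eq_mul, of_apply]
      ring
    rw [vecMulVec_mul, this, hv0, vecMulVec_zero]
  refine eq_zero_of_mulVec_eq_zero hQ ?_
  ext j
  exact (dotProduct_mulVec q (B j) x).symm.trans (hx j)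

end SquareNetwork

open SquareNetwork

/-- The crossed distribution of two EPR pairs over a square-shaped quantum network
whose four channels each have dimension 2 is impossible by SLOCC: there is no
square-network solution of dimension 2 over `ℂ`. -/
theorem no_square_network_solution_dim_two :
    ¬ ∃ A B C D : Fin 2 → Matrix (Fin 2) (Fin 2) ℂ,
      ∀ i j k l : Fin 2,
        (A i * B j * C k * D l).trace =
          (if i = k then 1 else 0) * (if j = l then 1 else 0) := by
  rintro ⟨A, B, C, D, h⟩
  have ht := trace_pencil_mul h
  obtain ⟨u, hu, hdet⟩ := exists_det_pencil_eq_zero A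
  obtain ⟨p, q, hpq⟩ := exists_eq_vecMulVec_of_det_eq_zero hdet
  obtain ⟨a, ha⟩ : ∃ a, u ⬝ᵥ a ≠ 0 := by
    by_contra! h0
    exact hu (dotProduct_eq_zero u h0)
  let w : Fin 2 → ℂ := ![-u 1, u 0]
  have huw : u ⬝ᵥ w = 0 := by
    simp [w, dotProduct, Fin.sum_univ_two]; ring
  obtain ⟨b, hb⟩ : ∃ b, b ⬝ᵥ w ≠ 0 := by
    refine ⟨![-a 1, a 0], fun h0 => ha ?_⟩
    simp [w, dotProduct, Fin.sum_univ_two] at h0 ⊢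
    linear_combination h0
  have hp : p ≠ 0 := by
    rintro rfl
    have := ht u (Pi.single 0 1) a (Pi.single 0 1)
    rw [hpq, zero_vecMulVec, zero_mul, zero_mul, zero_mul, trace_zero, single_one_dotProduct,
      Pi.single_eq_same, mul_one] at this
    exact ha this.symm
  have hAB : ∀ v, vecMulVec p q * pencil B v = 0 → v = 0 := by
    intro v hv
    refine dotProduct_eq_zero v fun z => ?_
    have := ht u v a z
    rw [hpq, hv, zero_mul, zero_mul, trace_zero] at this
    exact (mul_eq_zero.mp this.symm).resolve_left ha
  have hsingle : ∀ (M : Fin 2 → Matrix (Fin 2) (Fin 2) ℂ) j, pencil M (Pi.single j 1) = M j := by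
    intro M j
    fin_cases j <;> simp [pencil]
  have hCD : ∀ l, pencil C w *ᵥ (D l *ᵥ p) = 0 := by
    intro l
    refine eq_zero_of_dotProduct_mulVec_eq_zero hAB fun j => ?_
    have := ht u (Pi.single j 1) w (Pi.single l 1)
    rw [huw, zero_mul, hsingle, hsingle, hpq, vecMulVec_mul, vecMulVec_mul, vecMulVec_mul,
      trace_vecMulVec, dotProduct_comm] at this
    rwa [← dotProduct_mulVec, ← dotProduct_mulVec, ← dotProduct_mulVec] at this
  by_cases hC : (pencil C w).det = 0
  · obtain ⟨r, s, hrs⟩ := exists_eq_vecMulVec_of_det_eq_zero hC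
    have hr : r ≠ 0 := by
      rintro rfl
      have := ht b (Pi.single 0 1) w (Pi.single 0 1)
      rw [hrs, zero_vecMulVec, mul_zero, zero_mul, trace_zero, single_one_dotProduct,
        Pi.single_eq_same, mul_one] at this
      exact hb this.symm
    refine hp (eq_zero_of_dotProduct_mulVec_eq_zero (p := r) (q := s) (B := D) ?_ fun l => ?_)
    · intro z hz
      refine dotProduct_eq_zero z fun v => ?_
      have := ht b v w z
      rw [hrs, mul_assoc, hz, mul_zero, trace_zero, dotProduct_comm v] at this
      exact (mul_eq_zero.mp this.symm).resolve_left hb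
    · have := hCD l
      rw [hrs, vecMulVec_mulVec, op_smul_eq_smul] at this
      exact (smul_eq_zero.mp this).resolve_right hr
  · have hD : ∀ l, D l *ᵥ p = 0 := fun l => eq_zero_of_mulVec_eq_zero hC (hCD l)
    have := ht u (Pi.single 0 1) a (Pi.single 0 1)
    rw [hsingle, hsingle, hpq, mul_assoc, mul_assoc, trace_mul_comm, mul_assoc, mul_assoc,
      mul_vecMulVec, hD, zero_vecMulVec, mul_zero, mul_zero, trace_zero, single_one_dotProduct,
      Pi.single_eq_same, mul_one] at this
    exact ha this.symm
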